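/- There is no ring whose group of units is isomorphic to a quasi-cyclic p-group C_{p^∞}, for any prime p. -/

import Mathlib

/-- The quasi-cyclic (Prüfer) `p`-group, realized as the subgroup of `ℂˣ`
consisting of all `p`-power roots of unity. -/
def pruferGroup (p : ℕ) : Subgroup ℂˣ where
  carrier := {x | ∃ n : ℕ, x ^ p ^ n = 1}
  one_mem' := ⟨0, one_pow _⟩
  mul_mem' := by
    rintro a b ⟨m, hm⟩ ⟨n, hn⟩
    exact ⟨m + n, by
      rw [mul_pow, pow_add, pow_mul, hm, one_pow, one_mul, mul_comm (p ^ m), pow_mul, hn,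
        one_pow]⟩
  inv_mem' := by
    rintro a ⟨n, hn⟩
    exact ⟨n, by rw [inv_pow, hn, inv_one]⟩

section NumberTheory

/-- If `x` and `m` are odd and `x ^ m - 1` divides a power of two, then `x ^ m - 1` and `x - 1`
agree up to sign. -/
theorem natAbs_pow_sub_one_eq_of_dvd_two_pow {x : ℤ} {m f : ℕ} (hx : Odd x) (hm : Odd m)
    (h : x ^ m - 1 ∣ 2 ^ f) : (x ^ m - 1).natAbs = (x - 1).natAbs := by
  have hg := geom_sum_mul x m
  set T := ∑ i ∈ Finset.range m, x ^ i with hT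
  have hodd : Odd T := by
    rw [← ZMod.intCast_eq_one_iff_odd] at hx ⊢
    rw [hT]
    push_cast
    simp only [hx, one_pow, Finset.sum_const, Finset.card_range, nsmul_eq_mul, mul_one]
    exact ZMod.natCast_eq_one_iff_odd.2 hm
  have hunit : IsUnit T := by
    have hdvd : T ∣ 2 ^ f := (Dvd.intro _ hg).trans h
    have hcop : IsCoprime T (2 ^ f) :=
      IsCoprime.pow_right (Int.isCoprime_two_right.2 hodd)
    exact hcop.isUnit_of_dvd' dvd_rfl hdvd
  rw [← hg, Int.natAbs_mul, Int.isUnit_iff_natAbs_eq.1 hunit, one_mul]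

theorem le_one_of_two_pow_eq_prime_pow_add_one {p f m : ℕ} (hp : p.Prime) (hp2 : p ≠ 2)
    (h : 2 ^ f = p ^ m + 1) : m ≤ 1 := by
  have hpo : Odd p := hp.odd_of_ne_two hp2
  rcases Nat.even_or_odd m with ⟨l, rfl⟩ | hm
  · have hpl : Odd (p ^ l) := hpo.pow
    obtain ⟨c, hc⟩ := hpl
    have hf : f < 2 := by
      by_contra! hf
      obtain ⟨g, rfl⟩ := Nat.exists_eq_add_of_le hf
      rw [pow_add, pow_add, hc] at h
      have h' : 4 * 2 ^ g = 4 * (c * c + c) + 2 := by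
        rw [show 4 * 2 ^ g = 2 ^ 2 * 2 ^ g by ring, h]; ring
      omega
    have h1 : p ^ (l + l) = 1 := by
      have h3 : 0 < p ^ (l + l) := pow_pos hp.pos _
      interval_cases f <;> omega
    rcases Nat.pow_eq_one.1 h1 with h | h
    · exact absurd h hp.one_lt.ne'
    · omega
  · have hx : Odd (-(p : ℤ)) := (Int.odd_coe_nat p |>.2 hpo).neg
    have h' : (-(p : ℤ)) ^ m - 1 = -(2 ^ f) := by
      rw [hm.neg_pow]
      have : (2 : ℤ) ^ f = p ^ m + 1 := by exact_mod_cast h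
      rw [this]; ring
    have := natAbs_pow_sub_one_eq_of_dvd_two_pow (f := f) hx hm (by rw [h', neg_dvd])
    rw [h', Int.natAbs_neg, Int.natAbs_pow, show (2 : ℤ).natAbs = 2 from rfl, h] at this
    have h2 : p ^ m = p ^ 1 := by rw [pow_one]; omega
    exact (Nat.pow_right_injective hp.two_le h2).le

theorem lt_add_four_of_prime_pow_eq_two_pow_add_one {q f m : ℕ} (hq : q.Prime) (hq2 : q ≠ 2)
    (h : q ^ f = 2 ^ m + 1) : m < q + 4 := by
  have hqo : Odd q := hq.odd_of_ne_two hq2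
  rcases Nat.even_or_odd f with ⟨l, rfl⟩ | hf
  · have hmul : (q ^ l + 1) * (q ^ l - 1) = 2 ^ m := by
      rw [← Nat.sq_sub_sq, ← pow_mul, mul_two, h]; simp
    obtain ⟨b, -, hb⟩ := (Nat.dvd_prime_pow Nat.prime_two).1 (Dvd.intro _ hmul)
    obtain ⟨a, -, ha⟩ := (Nat.dvd_prime_pow Nat.prime_two).1 (Dvd.intro_left _ hmul)
    have hpos : 0 < q ^ l := pow_pos hq.pos _
    have hab : 2 ^ b = 2 ^ a + 2 := by
      have : 0 < 2 ^ a := by positivity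
      omega
    have ha2 : a < 2 := by
      by_contra! ha2
      obtain ⟨c, rfl⟩ := Nat.exists_eq_add_of_le ha2
      have hb2 : 2 ≤ b := by
        by_contra! hb2
        have : 0 < 2 ^ c := by positivity
        rw [pow_add] at hab
        interval_cases b <;> omega
      obtain ⟨d, rfl⟩ := Nat.exists_eq_add_of_le hb2
      rw [pow_add, pow_add] at hab
      omega
    have hq3 : q ^ l ≤ 3 := by interval_cases a <;> omega
    have hlt : 2 ^ m < 2 ^ 4 := by
      rw [← hmul]
      have : (q ^ l + 1) * (q ^ l - 1) ≤ 4 * 2 := Nat.mul_le_mul (by omega) (by omega)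
      omega
    have := (Nat.pow_lt_pow_iff_right one_lt_two).1 hlt
    omega
  · have h' : (q : ℤ) ^ f - 1 = 2 ^ m := by
      have : (q : ℤ) ^ f = 2 ^ m + 1 := by exact_mod_cast h
      rw [this]; ring
    have := natAbs_pow_sub_one_eq_of_dvd_two_pow (f := m) ((Int.odd_coe_nat q).2 hqo) hf
      (by rw [h'])
    rw [h', Int.natAbs_pow, show (2 : ℤ).natAbs = 2 from rfl] at this
    have h2 : m < 2 ^ m := Nat.lt_two_pow_self
    have := hq.pos
    omega

end NumberTheory

section FiniteRing

theorem exists_pow_isIdempotentElem {M : Type*} [Monoid M] [Finite M] (x : M) :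
    ∃ n, 0 < n ∧ IsIdempotentElem (x ^ n) := by
  obtain ⟨a, b, hab, h⟩ := Finite.exists_ne_map_eq_of_infinite fun n : ℕ => x ^ n
  wlog hlt : a < b generalizing a b
  · exact this b a hab.symm h.symm (by omega)
  obtain ⟨d, rfl⟩ := Nat.exists_eq_add_of_le hlt.le
  have hd : 0 < d := by omega
  have key : ∀ k c, a ≤ c → x ^ (c + d * k) = x ^ c := by
    intro k
    induction k with
    | zero => simp
    | succ k ih =>
      intro c hc
      obtain ⟨e, rfl⟩ := Nat.exists_eq_add_of_le hc
      have h' : x ^ a = x ^ (a + d) := h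
      rw [← ih _ hc, show a + e + d * (k + 1) = (a + d) + (e + d * k) by ring,
        pow_add, ← h', ← pow_add, add_assoc]
  refine ⟨d * (a + 1), by positivity, ?_⟩
  rw [IsIdempotentElem, ← pow_add]
  exact key _ _ (by nlinarith)

/-- The residue fields of a finite commutative ring whose units have `p`-power order have
`p ^ m + 1` elements. -/
theorem exists_card_quotient_eq_prime_pow_add_one {A : Type*} [CommRing A] [Finite A]
    (M : Ideal A) [M.IsMaximal] {p : ℕ} (hp : p.Prime)
    (h : ∀ u : Aˣ, ∃ k, u ^ p ^ k = 1) : ∃ m, Nat.card (A ⧸ M) = p ^ m + 1 := by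
  let _ := Ideal.Quotient.field M
  have := Fact.mk hp
  have : Finite (A ⧸ M) := Finite.of_surjective _ Ideal.Quotient.mk_surjective
  have hG : IsPGroup p (A ⧸ M)ˣ := by
    intro v
    obtain ⟨x, hx⟩ := Ideal.Quotient.mk_surjective (v : A ⧸ M)
    obtain ⟨n, hn, he⟩ := exists_pow_isIdempotentElem x
    obtain ⟨n, rfl⟩ := Nat.exists_eq_succ_of_ne_zero hn.ne'
    have he' : x ^ n * x * (x ^ n * x) = x ^ n * x := by simpa [IsIdempotentElem, pow_succ] using he
    have hmul : (x * x ^ (n + 1) + (1 - x ^ (n + 1))) *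
        (x ^ n * x ^ (n + 1) + (1 - x ^ (n + 1))) = 1 := by
      rw [pow_succ]
      linear_combination (x ^ n * x - x - x ^ n + 2) * he'
    obtain ⟨k, hk⟩ := h (Units.mkOfMulEqOne _ _ hmul)
    refine ⟨k, Units.ext ?_⟩
    have h1 := congrArg (fun u : Aˣ => Ideal.Quotient.mk M (u : A)) hk
    have h2 : (v : A ⧸ M) ^ (n + 1) = 1 := by
      have h3 := congrArg (Ideal.Quotient.mk M) he
      simp only [map_mul, map_pow, hx] at h3
      exact mul_left_cancel₀ (pow_ne_zero (n + 1) v.ne_zero) (by rw [h3, mul_one])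
    simpa [hx, h2] using h1
  obtain ⟨m, hm⟩ := IsPGroup.iff_card.1 hG
  refine ⟨m, ?_⟩
  rw [← hm, Nat.card_units]
  have : 0 < Nat.card (A ⧸ M) := Nat.card_pos
  omega

theorem exists_finite_subring_mem {R : Type*} [CommRing R] {n : ℕ} (hn : n ≠ 0) [CharP R n]
    {u : R} {k : ℕ} (hk : k ≠ 0) (hu : u ^ k = 1) : ∃ A : Subring R, Finite A ∧ u ∈ A := by
  have : NeZero n := ⟨hn⟩
  let _ := ZMod.algebra R n
  have hint : IsIntegral (ZMod n) u := .of_pow (Nat.pos_of_ne_zero hk) (hu ▸ isIntegral_one)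
  have : Module.Finite (ZMod n) (Algebra.adjoin (ZMod n) {u}) :=
    Module.Finite.of_fg hint.fg_adjoin_singleton
  exact ⟨(Algebra.adjoin (ZMod n) {u}).toSubring, Module.finite_of_finite (ZMod n),
    Algebra.self_mem_adjoin_singleton _ _⟩

end FiniteRing

section CommRing

variable {R : Type*} [CommRing R]

theorem Subring.units_pow_prime_pow_eq_one {S : Type*} [Ring S] {p : ℕ}
    (h : ∀ u : Sˣ, ∃ k, u ^ p ^ k = 1) (A : Subring S) (u : Aˣ) : ∃ k, u ^ p ^ k = 1 := by
  obtain ⟨k, hk⟩ := h (Units.map (A.subtype : A →* S) u)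
  refine ⟨k, Units.map_injective (f := (A.subtype : A →* S)) Subtype.val_injective ?_⟩
  rw [map_pow, hk, map_one]

/-- A commutative ring with units of odd prime power order only has no unit of order `p ^ 2`. -/
theorem orderOf_ne_prime_sq_of_odd {p : ℕ} (hp : p.Prime) (hp2 : p ≠ 2)
    (h : ∀ u : Rˣ, ∃ k, u ^ p ^ k = 1) (u : Rˣ) : orderOf u ≠ p ^ 2 := by
  intro hu
  have hodd : Odd p := hp.odd_of_ne_two hp2
  have htwo : (2 : R) = 0 := by
    obtain ⟨k, hk⟩ := h (-1)
    rw [hodd.pow.neg_one_pow] at hk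
    have := congrArg Units.val hk
    push_cast at this
    linear_combination -this
  have : Nontrivial R := by
    by_contra hR
    rw [not_nontrivial_iff_subsingleton] at hR
    rw [Subsingleton.elim u 1, orderOf_one] at hu
    exact (Nat.one_lt_pow two_ne_zero hp.one_lt).ne hu
  have : CharP R 2 := CharTwo.of_one_ne_zero_of_two_eq_zero one_ne_zero htwo
  have hu1 : (u : R) ^ p ^ 2 = 1 := by
    rw [← hu, ← Units.val_pow_eq_pow_val, pow_orderOf_eq_one, Units.val_one]
  obtain ⟨A, hA, huA⟩ := exists_finite_subring_mem two_ne_zero (pow_ne_zero 2 hp.ne_zero) hu1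
  set a : A := ⟨u, huA⟩
  have ha : a ^ p ^ 2 = 1 := Subtype.ext hu1
  have : CharP A 2 := CharP.subring R 2 A
  have hnil : ¬ IsNilpotent (a ^ p - 1) := by
    rintro ⟨k, hk⟩
    have h2 : (a ^ p - 1) ^ 2 ^ k = 0 := pow_eq_zero_of_le Nat.lt_two_pow_self.le hk
    rw [sub_pow_char_pow, one_pow, sub_eq_zero, ← pow_mul] at h2
    have h3 : u ^ (p * 2 ^ k) = 1 := Units.ext (by simpa [a] using congrArg Subtype.val h2)
    have h4 := orderOf_dvd_of_pow_eq_one h3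
    rw [hu, sq] at h4
    have h5 := hp.dvd_of_dvd_pow (Nat.dvd_of_mul_dvd_mul_left hp.pos h4)
    exact hp2 ((Nat.prime_dvd_prime_iff_eq hp Nat.prime_two).1 h5)
  rw [nilpotent_iff_mem_prime] at hnil
  push Not at hnil
  obtain ⟨M, hM, haM⟩ := hnil
  have : M.IsMaximal := IsArtinianRing.isMaximal_of_isPrime M
  obtain ⟨m, hm⟩ := exists_card_quotient_eq_prime_pow_add_one M hp
    (Subring.units_pow_prime_pow_eq_one h A)
  let _ := Ideal.Quotient.field M
  have : Finite (A ⧸ M) := Finite.of_surjective _ Ideal.Quotient.mk_surjective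
  let _ := Fintype.ofFinite (A ⧸ M)
  have : CharP (A ⧸ M) 2 := CharTwo.of_one_ne_zero_of_two_eq_zero one_ne_zero (by
    rw [← map_ofNat (Ideal.Quotient.mk M), CharTwo.two_eq_zero, map_zero])
  obtain ⟨f, -, hf⟩ := FiniteField.card (A ⧸ M) 2
  rw [Nat.card_eq_fintype_card] at hm
  have hle := le_one_of_two_pow_eq_prime_pow_add_one hp hp2 (hf.symm.trans hm)
  have := Fact.mk hp
  have hord : orderOf (Ideal.Quotient.mk M a) = p ^ (1 + 1) := by
    apply orderOf_eq_prime_pow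
    · rw [pow_one, ← map_pow, ← sub_eq_zero, ← map_one (Ideal.Quotient.mk M), ← map_sub,
        Ideal.Quotient.eq_zero_iff_mem]
      exact haM
    · rw [← map_pow, ha, map_one]
  have hdvd : p ^ 2 ∣ p ^ m := by
    rw [← hord]
    apply orderOf_dvd_of_pow_eq_one
    have hne : Ideal.Quotient.mk M a ≠ 0 := by
      intro h0
      rw [h0, orderOf_zero] at hord
      exact pow_ne_zero _ hp.ne_zero hord.symm
    have := FiniteField.pow_card_sub_one_eq_one _ hne
    rwa [hm, Nat.add_sub_cancel] at this
  have := (Nat.pow_dvd_pow_iff_le_right hp.one_lt).1 hdvd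
  omega

/-- In a commutative ring with at most one unit of order two, a nilpotent element whose square
divides `2` has vanishing cube. -/
theorem pow_three_eq_zero_of_isNilpotent {t c : R}
    (h : ∀ x y : Rˣ, x ^ 2 = 1 → y ^ 2 = 1 → x ≠ 1 → y ≠ 1 → x = y)
    (ht : IsNilpotent t) (hc : 2 = t ^ 2 * c) : t ^ 3 = 0 := by
  classical
  by_contra h3
  let m := Nat.find ht
  have hm : t ^ m = 0 := Nat.find_spec ht
  have hmin : ∀ k < m, t ^ k ≠ 0 := fun k hk => Nat.find_min ht hk
  have hm4 : 4 ≤ m := by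
    by_contra! hlt
    exact h3 (pow_eq_zero_of_le (by omega) hm)
  obtain ⟨n, hn⟩ := Nat.exists_eq_add_of_le hm4
  have key : ∀ j, n + 2 ≤ j → (1 + t ^ j) * (1 + t ^ j) = 1 := by
    intro j hj
    have h1 : t ^ (j + j) = 0 := pow_eq_zero_of_le (by omega) hm
    have h2 : t ^ (j + 2) = 0 := pow_eq_zero_of_le (by omega) hm
    rw [pow_add] at h1 h2
    linear_combination h1 + t ^ j * hc + c * h2
  have hxy := h (Units.mkOfMulEqOne _ _ (key (n + 2) le_rfl))
    (Units.mkOfMulEqOne _ _ (key (n + 3) (by omega)))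
    (Units.ext (by simpa [sq] using key (n + 2) le_rfl))
    (Units.ext (by simpa [sq] using key (n + 3) (by omega)))
    (fun he => hmin (n + 2) (by omega) (by simpa using congrArg Units.val he))
    (fun he => hmin (n + 3) (by omega) (by simpa using congrArg Units.val he))
  have heq : t ^ (n + 2) = t ^ (n + 3) := by simpa using congrArg Units.val hxy
  apply hmin (n + 3) (by omega)
  calc t ^ (n + 3) = t ^ (n + 2) * t := pow_succ _ _
    _ = t ^ (n + 4) := by rw [heq, ← pow_succ]
    _ = 0 := by rw [← hm, hn, add_comm]

/-- A power of `1 + √2` with positive norm has the form `a + b √2` with `a ^ 2 = 2 * b ^ 2 + 1`. -/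
theorem exists_three_add_two_mul_pow_eq {s : R} (hs : s ^ 2 = 2) (k : ℕ) :
    ∃ a b : ℕ, 1 < a ∧ a ^ 2 = 2 * b ^ 2 + 1 ∧ (3 + 2 * s) ^ (k + 1) = a + b * s := by
  induction k with
  | zero => exact ⟨3, 2, by norm_num, by norm_num, by push_cast; ring⟩
  | succ k ih =>
    obtain ⟨a, b, ha, hab, h⟩ := ih
    refine ⟨3 * a + 4 * b, 2 * a + 3 * b, by omega, by nlinarith, ?_⟩
    rw [pow_succ, h]
    push_cast
    linear_combination 2 * b * hs

/-- A commutative ring containing a square root `s` of `2` such that the unit `1 + s` has finite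
order has positive characteristic. -/
theorem exists_natCast_eq_zero_of_sq_eq_two {s : R} (hs : s ^ 2 = 2) {k : ℕ} (hk : k ≠ 0)
    (h : (1 + s) ^ k = 1) : ∃ n : ℕ, n ≠ 0 ∧ (n : R) = 0 := by
  obtain ⟨k, rfl⟩ := Nat.exists_eq_succ_of_ne_zero hk
  obtain ⟨a, b, ha, hab, hpow⟩ := exists_three_add_two_mul_pow_eq hs k
  have h1 : (3 + 2 * s) ^ (k + 1) = 1 := by
    rw [show 3 + 2 * s = (1 + s) ^ 2 by linear_combination -hs, ← pow_mul, mul_comm, pow_mul, h,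
      one_pow]
  rw [h1] at hpow
  have hab' : (a : R) ^ 2 = 2 * b ^ 2 + 1 := by exact_mod_cast congrArg (Nat.cast : ℕ → R) hab
  refine ⟨2 * (a - 1), by omega, ?_⟩
  rw [Nat.cast_mul, Nat.cast_sub ha.le]
  push_cast
  linear_combination hab' - b ^ 2 * hs - (1 - a + b * s) * hpow

/-- If all units of a commutative ring `R` have `2`-power order and `-1` has a `2 ^ j`-th root for
every `j`, then the characteristic of `R` has no odd prime divisor unless it is zero. -/
theorem not_dvd_char_of_odd_prime (h1 : ∀ u : Rˣ, ∃ k, u ^ 2 ^ k = 1)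
    (hroot : ∀ j, ∃ u : Rˣ, u ^ 2 ^ j = -1) {n q : ℕ} (hn : n ≠ 0) [CharP R n] (hq : q.Prime)
    (hq2 : q ≠ 2) : ¬ q ∣ n := by
  rintro ⟨c, rfl⟩
  obtain ⟨u, hu⟩ := hroot (q + 3)
  have hu' : (u : R) ^ 2 ^ (q + 3) = -1 := by simpa using congrArg Units.val hu
  obtain ⟨A, hA, huA⟩ := exists_finite_subring_mem hn (k := 2 ^ (q + 3 + 1)) (by positivity)
    (show (u : R) ^ 2 ^ (q + 3 + 1) = 1 by rw [pow_succ 2, pow_mul, hu']; ring)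
  set a : A := ⟨u, huA⟩
  have ha : a ^ 2 ^ (q + 3) = -1 := Subtype.ext hu'
  have : CharP A (q * c) := CharP.subring R _ A
  have hc : c ≠ 0 := right_ne_zero_of_mul hn
  have hqA : (q : A) ∈ nonunits A := by
    intro hunit
    have h0 : (q : A) * c = 0 := by rw [← Nat.cast_mul, CharP.cast_eq_zero]
    have hdvd := (CharP.cast_eq_zero_iff A (q * c) c).1 (hunit.mul_right_eq_zero.1 h0)
    exact absurd (Nat.le_of_dvd (Nat.pos_of_ne_zero hc) hdvd)
      (not_le.2 (lt_mul_of_one_lt_left (Nat.pos_of_ne_zero hc) hq.one_lt))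
  obtain ⟨M, hM, hqM⟩ := exists_max_ideal_of_mem_nonunits hqA
  obtain ⟨m, hm⟩ := exists_card_quotient_eq_prime_pow_add_one M Nat.prime_two
    (Subring.units_pow_prime_pow_eq_one h1 A)
  let _ := Ideal.Quotient.field M
  have : Finite (A ⧸ M) := Finite.of_surjective _ Ideal.Quotient.mk_surjective
  let _ := Fintype.ofFinite (A ⧸ M)
  have hchar : ringChar (A ⧸ M) = q := CharP.ringChar_of_prime_eq_zero hq (by
    rw [← map_natCast (Ideal.Quotient.mk M)]
    exact Ideal.Quotient.eq_zero_iff_mem.2 hqM)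
  have : CharP (A ⧸ M) q := ringChar.of_eq hchar
  obtain ⟨f, -, hf⟩ := FiniteField.card (A ⧸ M) q
  rw [Nat.card_eq_fintype_card] at hm
  have hlt := lt_add_four_of_prime_pow_eq_two_pow_add_one hq hq2 (hf.symm.trans hm)
  have hroot' : Ideal.Quotient.mk M a ^ 2 ^ (q + 3) = -1 := by rw [← map_pow, ha, map_neg, map_one]
  have hord : orderOf (Ideal.Quotient.mk M a) = 2 ^ (q + 3 + 1) := by
    apply orderOf_eq_prime_pow
    · rw [hroot']
      exact Ring.neg_one_ne_one_of_char_ne_two (hchar.trans_ne hq2)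
    · rw [pow_succ 2, pow_mul, hroot', neg_one_sq]
  have hdvd : 2 ^ (q + 4) ∣ 2 ^ m := by
    rw [← hord]
    apply orderOf_dvd_of_pow_eq_one
    have hne : Ideal.Quotient.mk M a ≠ 0 := by
      intro h0
      rw [h0, orderOf_zero] at hord
      exact pow_ne_zero _ two_ne_zero hord.symm
    have := FiniteField.pow_card_sub_one_eq_one _ hne
    rwa [hm, Nat.add_sub_cancel] at this
  have := (Nat.pow_dvd_pow_iff_le_right one_lt_two).1 hdvd
  omega

/-- There is no commutative ring whose units all have `2`-power order, arbitrarily large orders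
occurring, with at most one unit of order two. -/
theorem not_units_two_quasicyclic (h1 : ∀ u : Rˣ, ∃ k, u ^ 2 ^ k = 1)
    (h2 : ∀ j : ℕ, ∃ u : Rˣ, orderOf u = 2 ^ j)
    (h3 : ∀ x y : Rˣ, x ^ 2 = 1 → y ^ 2 = 1 → x ≠ 1 → y ≠ 1 → x = y) : False := by
  by_cases htwo : (2 : R) = 0
  · obtain ⟨u, hu⟩ := h2 3
    have : Nontrivial R := by
      by_contra hR
      rw [not_nontrivial_iff_subsingleton] at hR
      rw [Subsingleton.elim u 1, orderOf_one] at hu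
      omega
    have : CharP R 2 := CharTwo.of_one_ne_zero_of_two_eq_zero one_ne_zero htwo
    have hpow : ∀ k, ((u : R) - 1) ^ 2 ^ k = (u : R) ^ 2 ^ k - 1 := fun k => by
      rw [sub_pow_char_pow, one_pow]
    have hu3 : (u : R) ^ 2 ^ 3 = 1 := by
      rw [← hu, ← Units.val_pow_eq_pow_val, pow_orderOf_eq_one, Units.val_one]
    have hnil : IsNilpotent ((u : R) - 1) := ⟨2 ^ 3, by rw [hpow, hu3, sub_self]⟩
    have h0 := pow_three_eq_zero_of_isNilpotent (c := 0) h3 hnil (by rw [htwo, mul_zero])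
    have h4 := hpow 2
    rw [pow_eq_zero_of_le (by norm_num) h0, eq_comm, sub_eq_zero] at h4
    have h5 := orderOf_dvd_of_pow_eq_one (Units.ext (by simpa using h4) : u ^ 2 ^ 2 = 1)
    rw [hu] at h5
    norm_num at h5
  have hneg : (-1 : Rˣ) ≠ 1 := fun h => htwo (by
    have := congrArg Units.val h
    push_cast at this
    linear_combination -this)
  have hprim : ∀ j, ∃ u : Rˣ, u ^ 2 ^ j = -1 := by
    intro j
    obtain ⟨u, hu⟩ := h2 (j + 1)
    refine ⟨u, h3 _ _ ?_ (by simp) (fun h => ?_) hneg⟩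
    · rw [← pow_mul, ← pow_succ, ← hu, pow_orderOf_eq_one]
    · have h4 := orderOf_dvd_of_pow_eq_one h
      rw [hu, Nat.pow_dvd_pow_iff_le_right one_lt_two] at h4
      omega
  obtain ⟨v, hv⟩ := hprim 3
  set w : R := ((v⁻¹ : Rˣ) : R)
  have hvw : (v : R) * w = 1 := v.mul_inv
  have hv8 : (v : R) ^ 8 = -1 := by simpa using congrArg Units.val hv
  obtain ⟨t, ht⟩ : ∃ t : R, t = v + w := ⟨_, rfl⟩
  obtain ⟨s, hst⟩ : ∃ s : R, s = t ^ 2 - 2 := ⟨_, rfl⟩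
  have hs2 : s ^ 2 = 2 := by
    have hs' : s = v ^ 2 + w ^ 2 := by rw [hst, ht]; linear_combination 2 * hvw
    have hw4 : (v : R) ^ 4 = - w ^ 4 := by
      calc (v : R) ^ 4 = v ^ 8 * w ^ 4 - v ^ 4 * ((v * w) ^ 4 - 1) := by ring
        _ = -w ^ 4 := by rw [hvw, hv8]; ring
    rw [hs']
    linear_combination hw4 + (2 * (v * w) + 2) * hvw
  have hunit : (1 + s) * (s - 1) = 1 := by linear_combination hs2
  have hcharne : ∃ n : ℕ, n ≠ 0 ∧ (n : R) = 0 := by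
    obtain ⟨k, hk⟩ := h1 (Units.mkOfMulEqOne _ _ hunit)
    exact exists_natCast_eq_zero_of_sq_eq_two hs2 (k := 2 ^ k) (by positivity)
      (by simpa using congrArg Units.val hk)
  obtain ⟨n, hn⟩ := CharP.exists R
  have hn0 : n ≠ 0 := by
    obtain ⟨c, hc, hc0⟩ := hcharne
    rintro rfl
    exact hc (by simpa using (CharP.cast_eq_zero_iff R 0 c).1 hc0)
  have hnpow : ∃ a, n = 2 ^ a := by
    rcases Nat.eq_two_pow_or_exists_odd_prime_and_dvd n with ha | ⟨q, hq, hqn, hqo⟩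
    · exact ha
    · refine absurd hqn (not_dvd_char_of_odd_prime h1 hprim hn0 hq ?_)
      rintro rfl
      exact absurd hqo (by decide)
  obtain ⟨a, ha⟩ := hnpow
  have h2nil : IsNilpotent (2 : R) := ⟨a, by
    rw [← Nat.cast_ofNat, ← Nat.cast_pow, ← ha, CharP.cast_eq_zero]⟩
  have hts : t ^ 2 = s * (1 + s) := by rw [hst] at hs2 ⊢; linear_combination -hs2
  have ht4 : 2 = t ^ 4 * (s - 1) ^ 2 := by
    rw [show t ^ 4 = (t ^ 2) ^ 2 by ring, hts, ← hs2]
    linear_combination - s ^ 2 * ((1 + s) * (s - 1) + 1) * hunit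
  have htnil : IsNilpotent t := by
    obtain ⟨b, hb⟩ := h2nil
    refine ⟨4 * b, ?_⟩
    rw [pow_mul, show t ^ 4 = 2 * (1 + s) ^ 2 by
      rw [show t ^ 4 = (t ^ 2) ^ 2 by ring, hts, mul_pow, hs2], mul_pow, hb, zero_mul]
  have h0 := pow_three_eq_zero_of_isNilpotent (c := t ^ 2 * (s - 1) ^ 2) h3 htnil
    (by rw [ht4]; ring)
  apply htwo
  rw [ht4]
  linear_combination t * (s - 1) ^ 2 * h0

end CommRing

section Prufer

theorem exists_orderOf_pruferGroup_eq {p : ℕ} (hp : p.Prime) (j : ℕ) :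
    ∃ x : pruferGroup p, orderOf x = p ^ j := by
  have hne : p ^ j ≠ 0 := pow_ne_zero j hp.ne_zero
  obtain ⟨ζ, hζ⟩ : ∃ ζ : ℂˣ, IsPrimitiveRoot ζ (p ^ j) :=
    ⟨_, (Complex.isPrimitiveRoot_exp (p ^ j) hne).isUnit_unit hne⟩
  have hmem : ζ ∈ pruferGroup p := ⟨j, hζ.pow_eq_one⟩
  exact ⟨⟨ζ, hmem⟩, by rw [Subgroup.orderOf_mk, ← hζ.eq_orderOf]⟩

theorem pruferGroup_eq_of_sq_eq_one {p : ℕ} (x y : pruferGroup p) (hx : x ^ 2 = 1)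
    (hy : y ^ 2 = 1) (hx1 : x ≠ 1) (hy1 : y ≠ 1) : x = y := by
  have key : ∀ z : pruferGroup p, z ^ 2 = 1 → z ≠ 1 → ((z : ℂˣ) : ℂ) = -1 := by
    intro z hz hz1
    have h2 : ((z : ℂˣ) : ℂ) ^ 2 = 1 := by
      simpa using congrArg (fun w : pruferGroup p => ((w : ℂˣ) : ℂ)) hz
    exact (eq_or_eq_neg_of_sq_eq_sq _ _ (by rw [h2, one_pow])).resolve_left
      fun h => hz1 (Subtype.ext (Units.ext h))
  exact Subtype.ext (Units.ext ((key x hx hx1).trans (key y hy hy1).symm))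

end Prufer

theorem fuchs_stmt18 (p : ℕ) (hp : p.Prime) :
    ¬ ∃ (R : Type) (_ : Ring R), Nonempty (Rˣ ≃* pruferGroup p) := by
  rintro ⟨R, _, ⟨e⟩⟩
  have h1 : ∀ u : Rˣ, ∃ k, u ^ p ^ k = 1 := by
    intro u
    obtain ⟨k, hk⟩ := (e u).2
    exact ⟨k, e.injective (by rw [map_pow, map_one]; exact Subtype.ext hk)⟩
  have hcomm : ∀ x ∈ Set.range (Units.val : Rˣ → R), ∀ y ∈ Set.range (Units.val : Rˣ → R),
      x * y = y * x := by
    rintro _ ⟨x, rfl⟩ _ ⟨y, rfl⟩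
    rw [← Units.val_mul, ← Units.val_mul,
      e.injective (by rw [map_mul, map_mul, mul_comm] : e (x * y) = e (y * x))]
  let S := Subring.closure (Set.range (Units.val : Rˣ → R))
  have : IsMulCommutative S := Subring.isMulCommutative_closure hcomm
  let _ : CommRing S := { mul_comm := mul_comm' }
  let φ : Sˣ →* Rˣ := Units.map (S.subtype : S →* R)
  have hφ : Function.Injective φ := Units.map_injective Subtype.val_injective
  have hφs : ∀ u : Rˣ, ∃ v : Sˣ, φ v = u := fun u =>
    ⟨⟨⟨u, Subring.subset_closure ⟨u, rfl⟩⟩, ⟨(u⁻¹ : Rˣ), Subring.subset_closure ⟨u⁻¹, rfl⟩⟩,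
      Subtype.ext u.mul_inv, Subtype.ext u.inv_mul⟩, Units.ext rfl⟩
  have h1S : ∀ u : Sˣ, ∃ k, u ^ p ^ k = 1 := Subring.units_pow_prime_pow_eq_one h1 S
  have h2S : ∀ j : ℕ, ∃ u : Sˣ, orderOf u = p ^ j := by
    intro j
    obtain ⟨x, hx⟩ := exists_orderOf_pruferGroup_eq hp j
    obtain ⟨v, hv⟩ := hφs (e.symm x)
    exact ⟨v, by rw [← orderOf_injective φ hφ, hv, e.symm.orderOf_eq, hx]⟩
  by_cases hp2 : p = 2
  · subst hp2
    refine not_units_two_quasicyclic h1S h2S fun x y hx hy hx1 hy1 => ?_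
    have hinj : Function.Injective (e.toMonoidHom.comp φ) := e.injective.comp hφ
    exact hinj (pruferGroup_eq_of_sq_eq_one _ _ (by rw [← map_pow, hx, map_one])
      (by rw [← map_pow, hy, map_one]) (by rwa [Ne, map_eq_one_iff _ hinj])
      (by rwa [Ne, map_eq_one_iff _ hinj]))
  · obtain ⟨u, hu⟩ := h2S 2
    exact orderOf_ne_prime_sq_of_odd hp hp2 h1S u hu
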